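/- Let A be a multipartition matrix with k blocks satisfying the GRIP, let Ā be the matrix obtained from A by removing all repeated columns (with m̄ columns), and for a normalized positive data vector d for A let d̄_j be the sum of the entries of d over the columns of A equal to the j-th column of Ā. Then the MLE of d̄ in the partition model M_{Ā} is φ_{Ā}(s^1_1(d̄),…,s^k_{n_k}(d̄)), the image under the monomial map of Ā of the parameter vector with entries s^ℓ_i(d̄) = (ᾱ^ℓ_i · d̄)/(Σ_{ᾱ^ℓ_{i′} ∈ F^ℓ[i]} ᾱ^ℓ_{i′} · d̄); i.e., its j-th component is ∏_{ℓ=1}^k s^ℓ_{S(ℓ,j)}(d̄). -/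

import Mathlib

open Finset

namespace PM

variable {k : ℕ} {J : Type*} {I : Type*} [Fintype J] [DecidableEq J] [DecidableEq I]

/- A partition matrix (a 0/1 matrix in which every column sums to 1), with columns
indexed by `J` and rows indexed by `I`, is encoded by the map sending each column to the
unique row having a 1 in that column.  A multipartition matrix with `k` blocks is a
family `S : Fin k → J → I` of such maps (block `b` is the partition matrix whose row
through column `j` is `S b j`). -/

/-- Columns `j` and `j'` agree in the first `ℓ` blocks (blocks of index `< ℓ`). -/
def colEquiv (S : Fin k → J → I) (ℓ : ℕ) (j j' : J) : Prop :=
  ∀ b : Fin k, (b : ℕ) < ℓ → S b j = S b j'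

instance {S : Fin k → J → I} {ℓ : ℕ} {j j' : J} : Decidable (colEquiv S ℓ j j') :=
  inferInstanceAs (Decidable (∀ b : Fin k, (b : ℕ) < ℓ → S b j = S b j'))

/-- The column weight `c^ℓ_j` of column `j` in the stacked matrix of the first `ℓ` blocks. -/
def colWeight (S : Fin k → J → I) (ℓ : ℕ) (j : J) : ℕ :=
  (univ.filter fun j' => colEquiv S ℓ j j').card

/-- Well-connectedness: for every block `b` and all columns `j`, `j'` in the support of one
row of block `b`, `c^{b+1}_j / c^{b}_j = c^{b+1}_{j'} / c^{b}_{j'}` (cross-multiplied;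
here `b+1` counts blocks, so `colWeight S ((b:ℕ)+1)` includes block `b`, and the
condition is trivially true for the first block). -/
def WellConnected (S : Fin k → J → I) : Prop :=
  ∀ (b : Fin k) (j j' : J), S b j = S b j' →
    colWeight S ((b : ℕ) + 1) j * colWeight S (b : ℕ) j' =
      colWeight S ((b : ℕ) + 1) j' * colWeight S (b : ℕ) j

/-- The set of rows of block `b` connected to the row of `B_b = ∪_{n<b} A^n` supported
on column `j` (a floret of block `b`, represented by the column `j`). -/
def stage (S : Fin k → J → I) (b : Fin k) (j : J) : Finset I :=
  (univ.filter fun j' => colEquiv S (b : ℕ) j j').image (S b)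

/-- The pair `(∪_{n<b} A^n, A^b)` satisfies the floret condition: the sets of rows of the
block `b` connected to two rows of `B_b` are equal or disjoint. -/
def FloretCondition (S : Fin k → J → I) (b : Fin k) : Prop :=
  ∀ j j' : J, stage S b j = stage S b j' ∨ Disjoint (stage S b j) (stage S b j')

/-- The `i`-th row of block `b`, as a real vector. -/
def rowVec (S : Fin k → J → I) (b : Fin k) (i : I) : J → ℝ :=
  fun j => if S b j = i then 1 else 0

/-- `α^b_i · d`, the dot product of the `i`-th row of block `b` with `d`. -/
def rowDot (S : Fin k → J → I) (b : Fin k) (i : I) (d : J → ℝ) : ℝ :=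
  ∑ j, (if S b j = i then d j else 0)

/-- The set of rows of the stacked matrix consisting of the first `ℓ` blocks. -/
def prefixRows (S : Fin k → J → I) (ℓ : ℕ) : Set (J → ℝ) :=
  {v | ∃ (b : Fin k) (i : I), (b : ℕ) < ℓ ∧ v = rowVec S b i}

/-- The row of `D = B_b ∩ A^b` through column `j0` (the indicator vector of the columns
whose floret pair is that of `j0`). -/
def dRow (S : Fin k → J → I) (b : Fin k) (j0 : J) : J → ℝ :=
  fun j => if stage S b j = stage S b j0 then 1 else 0

/-- The generalized running intersection property: for every block `b ≥ 1` (paper: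
`ℓ + 1` with `1 ≤ ℓ ≤ k-1`), (1) the stacked matrix of `B_b = ∪_{n<b}A^n` and `A^b` is
well-connected, (2) the pair `(B_b, A^b)` satisfies the floret condition, and (3) every
row of `B_b ∩ A^b` lies in the real row span of the first `b` blocks. -/
def GRIP (S : Fin k → J → I) : Prop :=
  ∀ b : Fin k, 0 < (b : ℕ) →
    (∀ j j' : J, S b j = S b j' →
      colWeight S ((b : ℕ) + 1) j * colWeight S (b : ℕ) j' =
        colWeight S ((b : ℕ) + 1) j' * colWeight S (b : ℕ) j) ∧
    FloretCondition S b ∧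
    (∀ j0 : J, dRow S b j0 ∈ Submodule.span ℝ (prefixRows S (b : ℕ)))

/-- The level-`b` floret `F^b[i]` containing the `i`-th row of block `b`. -/
def floret (S : Fin k → J → I) (b : Fin k) (i : I) : Finset I :=
  (univ.filter fun j => S b j = i).biUnion fun j => stage S b j

/-- `Σ_{i' ∈ F^b[i]} α^b_{i'} · d`. -/
def floretSum (S : Fin k → J → I) (b : Fin k) (i : I) (d : J → ℝ) : ℝ :=
  ∑ j, (if S b j ∈ floret S b i then d j else 0)

/-- The likelihood `∏_j p_j^{d_j}` of data `d` at the point `p`. -/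
noncomputable def likelihood (d p : J → ℝ) : ℝ := ∏ j, p j ^ d j

/-- The log-linear (partition) model determined by a set of rows: probability
vectors with positive entries whose coordinatewise logarithm lies in the row span. -/
def inModel (Rows : Set (J → ℝ)) (p : J → ℝ) : Prop :=
  (∀ j, 0 < p j) ∧ (∑ j, p j) = 1 ∧
    (fun j => Real.log (p j)) ∈ Submodule.span ℝ Rows

/-- `p` is a maximum likelihood estimate for the data `d` in the model determined by
`Rows`: it maximizes the likelihood over the closure of the model. -/
def IsMLE (Rows : Set (J → ℝ)) (d p : J → ℝ) : Prop :=
  p ∈ closure {q | inModel Rows q} ∧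
    ∀ q ∈ closure {q | inModel Rows q}, likelihood d q ≤ likelihood d p

/-- The iterative proportional scaling iterates: `ips S d 0` is the uniform
distribution, and step `ℓ+1` rescales by the `ℓ`-th block (`q^{ℓ+1}_j =
q^ℓ_j ⬝ (α^ℓ_{S(ℓ,j)} · d) / (α^ℓ_{S(ℓ,j)} · q^ℓ)`). -/
noncomputable def ips (S : Fin k → J → I) (d : J → ℝ) : ℕ → J → ℝ
  | 0 => fun _ => (Fintype.card J : ℝ)⁻¹
  | ℓ + 1 => fun j =>
      if h : ℓ < k then
        ips S d ℓ j * rowDot S ⟨ℓ, h⟩ (S ⟨ℓ, h⟩ j) d /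
          rowDot S ⟨ℓ, h⟩ (S ⟨ℓ, h⟩ j) (ips S d ℓ)
      else ips S d ℓ j

end PM

namespace PM

section helpers

set_option linter.unusedSectionVars false

variable {k : ℕ} {J : Type*} {I : Type*} [Fintype J] [DecidableEq J] [DecidableEq I]

lemma colEquiv_refl' (S : Fin k → J → I) (l : ℕ) (j : J) : colEquiv S l j j := fun _ _ => rfl

lemma colEquiv_symm' {S : Fin k → J → I} {l : ℕ} {j j' : J} (h : colEquiv S l j j') :
    colEquiv S l j' j := fun b hb => (h b hb).symm

lemma colEquiv_trans' {S : Fin k → J → I} {l : ℕ} {j j' j'' : J} (h : colEquiv S l j j')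
    (h' : colEquiv S l j' j'') : colEquiv S l j j'' := fun b hb => (h b hb).trans (h' b hb)

lemma colEquiv_comm' {S : Fin k → J → I} {l : ℕ} {j j' : J} :
    colEquiv S l j j' ↔ colEquiv S l j' j := ⟨colEquiv_symm', colEquiv_symm'⟩

lemma colEquiv_succ' {S : Fin k → J → I} {b : Fin k} {j j' : J} :
    colEquiv S ((b : ℕ) + 1) j j' ↔ colEquiv S (b : ℕ) j j' ∧ S b j = S b j' := by
  constructor
  · intro h
    exact ⟨fun c hc => h c (by omega), h b (by omega)⟩
  · rintro ⟨h, h2⟩ c hc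
    by_cases hcb : (c : ℕ) < b
    · exact h c hcb
    · have : c = b := Fin.ext (by omega)
      rw [this]; exact h2

lemma colWeight_pos' (S : Fin k → J → I) (l : ℕ) (j : J) : 0 < colWeight S l j :=
  Finset.card_pos.mpr ⟨j, by simp [colEquiv_refl']⟩

lemma colWeight_congr {S : Fin k → J → I} {l : ℕ} {j j' : J} (h : colEquiv S l j j') :
    colWeight S l j = colWeight S l j' := by
  unfold colWeight
  congr 1
  ext x
  simp only [mem_filter, mem_univ, true_and]
  exact ⟨fun hx => colEquiv_trans' (colEquiv_symm' h) hx, fun hx => colEquiv_trans' h hx⟩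

lemma mem_stage {S : Fin k → J → I} {b : Fin k} {j : J} {i : I} :
    i ∈ stage S b j ↔ ∃ j', colEquiv S (b : ℕ) j j' ∧ S b j' = i := by
  simp [stage]

lemma self_mem_stage (S : Fin k → J → I) (b : Fin k) (j : J) : S b j ∈ stage S b j :=
  mem_stage.2 ⟨j, colEquiv_refl' _ _ _, rfl⟩

lemma mem_stage_iff {S : Fin k → J → I} {b : Fin k} (hF : FloretCondition S b) (j j0 : J) :
    S b j0 ∈ stage S b j ↔ stage S b j = stage S b j0 := by
  constructor
  · intro h
    rcases hF j j0 with h1 | h1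
    · exact h1
    · exact absurd (self_mem_stage S b j0) (Finset.disjoint_left.1 h1 h)
  · intro h
    rw [h]; exact self_mem_stage S b j0

lemma floret_eq {S : Fin k → J → I} {b : Fin k} (hF : FloretCondition S b) (j0 : J) :
    floret S b (S b j0) = stage S b j0 := by
  ext i
  simp only [floret, mem_biUnion, mem_filter, mem_univ, true_and]
  constructor
  · rintro ⟨j, hj, hi⟩
    have := (mem_stage_iff hF j j0).1 (hj ▸ self_mem_stage S b j)
    rwa [← this]
  · intro h
    exact ⟨j0, rfl, h⟩

lemma floretSum_eq_dRow {S : Fin k → J → I} {b : Fin k} (hF : FloretCondition S b) (j0 : J)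
    (d : J → ℝ) : floretSum S b (S b j0) d = ∑ j, dRow S b j0 j * d j := by
  unfold floretSum dRow
  refine Finset.sum_congr rfl fun j _ => ?_
  rw [floret_eq hF, ite_mul, one_mul, zero_mul]
  have h := mem_stage_iff hF j0 j
  by_cases hh : stage S b j = stage S b j0
  · rw [if_pos hh, if_pos (h.2 hh.symm)]
  · rw [if_neg hh, if_neg (fun h' => hh (h.1 h').symm)]

lemma floretSum_eq_sum {S : Fin k → J → I} {b : Fin k} (hF : FloretCondition S b) (j0 : J)
    (d : J → ℝ) : floretSum S b (S b j0) d = ∑ i ∈ stage S b j0, rowDot S b i d := by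
  unfold floretSum rowDot
  rw [Finset.sum_comm]
  refine Finset.sum_congr rfl fun j _ => ?_
  rw [floret_eq hF, Finset.sum_ite_eq]

lemma floretSum_pos {S : Fin k → J → I} {b : Fin k} (hF : FloretCondition S b) (j0 : J)
    (d : J → ℝ) (hd : ∀ j, 0 < d j) : 0 < floretSum S b (S b j0) d := by
  unfold floretSum
  refine Finset.sum_pos' (fun j _ => ?_) ⟨j0, mem_univ _, ?_⟩
  · split_ifs
    · exact (hd j).le
    · exact le_rfl
  · rw [floret_eq hF, if_pos (self_mem_stage S b j0)]; exact hd j0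

lemma rowDot_pos (S : Fin k → J → I) (b : Fin k) (j0 : J)
    (d : J → ℝ) (hd : ∀ j, 0 < d j) : 0 < rowDot S b (S b j0) d := by
  unfold rowDot
  refine Finset.sum_pos' (fun j _ => ?_) ⟨j0, mem_univ _, ?_⟩
  · split_ifs
    · exact (hd j).le
    · exact le_rfl
  · rw [if_pos rfl]; exact hd j0

/-- The parameters `s^b_i(d)`. -/
noncomputable def sPar (S : Fin k → J → I) (d : J → ℝ) (b : Fin k) (i : I) : ℝ :=
  rowDot S b i d / floretSum S b i d

lemma sum_sPar {S : Fin k → J → I} {b : Fin k} (hF : FloretCondition S b) (j0 : J)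
    (d : J → ℝ) (hd : ∀ j, 0 < d j) : ∑ i ∈ stage S b j0, sPar S d b i = 1 := by
  have h : ∀ i ∈ stage S b j0, sPar S d b i = rowDot S b i d / floretSum S b (S b j0) d := by
    intro i hi
    obtain ⟨j', hj', rfl⟩ := mem_stage.1 hi
    unfold sPar
    congr 1
    rw [floretSum_eq_sum hF, floretSum_eq_sum hF, (mem_stage_iff hF j0 j').1 hi]
  rw [Finset.sum_congr rfl h, ← Finset.sum_div, ← floretSum_eq_sum hF,
    div_self (floretSum_pos hF j0 d hd).ne']

lemma sum_stage (S : Fin k → J → I) (b : Fin k) (j : J) (u : I → ℝ) :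
    ∑ i ∈ stage S b j, u i =
      ∑ j', if colEquiv S (b : ℕ) j j' then u (S b j') / colWeight S ((b : ℕ) + 1) j' else 0 := by
  rw [← Finset.sum_filter, stage,
    ← Finset.sum_fiberwise_of_maps_to (g := S b) (t := (univ.filter fun j' => colEquiv S (b : ℕ) j j').image (S b))
      (fun x hx => Finset.mem_image_of_mem _ hx)]
  refine Finset.sum_congr rfl fun i hi => ?_
  obtain ⟨j0, hj0, rfl⟩ := Finset.mem_image.1 hi
  simp only [mem_filter, mem_univ, true_and] at hj0
  have hset : ((univ.filter fun j' => colEquiv S (b : ℕ) j j').filter fun x => S b x = S b j0)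
      = univ.filter fun j' => colEquiv S ((b : ℕ) + 1) j0 j' := by
    ext x
    simp only [mem_filter, mem_univ, true_and, colEquiv_succ']
    exact ⟨fun h => ⟨colEquiv_trans' (colEquiv_symm' hj0) h.1, h.2.symm⟩,
      fun h => ⟨colEquiv_trans' hj0 h.1, h.2.symm⟩⟩
  rw [hset, Finset.sum_congr rfl (g := fun _ => u (S b j0) / colWeight S ((b : ℕ) + 1) j0)]
  · rw [Finset.sum_const, nsmul_eq_mul]
    have : (0 : ℝ) < colWeight S ((b : ℕ) + 1) j0 := Nat.cast_pos.2 (colWeight_pos' _ _ _)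
    change u (S b j0) = (colWeight S ((b : ℕ) + 1) j0 : ℝ) * _
    field_simp
  · intro x hx
    simp only [mem_filter, mem_univ, true_and] at hx
    rw [colWeight_congr hx, (colEquiv_succ'.1 hx).2]

lemma avg (S : Fin k → J → I) (b : Fin k) (f : J → ℝ)
    (hf : ∀ j j', colEquiv S (b : ℕ) j j' → f j = f j') (u : I → ℝ) :
    ∑ j, f j * (colWeight S (b : ℕ) j / colWeight S ((b : ℕ) + 1) j * u (S b j)) =
      ∑ j, f j * ∑ i ∈ stage S b j, u i := by
  simp_rw [sum_stage, Finset.mul_sum]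
  rw [Finset.sum_comm]
  refine Finset.sum_congr rfl fun j' _ => ?_
  have : ∀ j ∈ (univ : Finset J), (f j * if colEquiv S (b : ℕ) j j' then u (S b j') / colWeight S ((b : ℕ) + 1) j' else 0)
     = if colEquiv S (b : ℕ) j' j then f j' * (u (S b j') / colWeight S ((b : ℕ) + 1) j') else 0 := by
    intro j _
    by_cases h : colEquiv S (b : ℕ) j j'
    · rw [if_pos h, if_pos (colEquiv_symm' h), hf j j' h]
    · rw [if_neg h, if_neg (fun h' => h (colEquiv_symm' h')), mul_zero]
  rw [Finset.sum_congr rfl this, ← Finset.sum_filter, Finset.sum_const, nsmul_eq_mul]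
  change _ = (colWeight S (b : ℕ) j' : ℝ) * _
  ring

/-- Partial products. -/
noncomputable def pPart (S : Fin k → J → I) (d : J → ℝ) (l : ℕ) (j : J) : ℝ :=
  ∏ b ∈ univ.filter (fun b : Fin k => (b : ℕ) < l), sPar S d b (S b j)

noncomputable def qPart (S : Fin k → J → I) (d : J → ℝ) (l : ℕ) (j : J) : ℝ :=
  pPart S d l j / colWeight S l j

lemma pPart_succ (S : Fin k → J → I) (d : J → ℝ) (b : Fin k) (j : J) :
    pPart S d ((b : ℕ) + 1) j = pPart S d b j * sPar S d b (S b j) := by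
  unfold pPart
  have : (univ.filter fun c : Fin k => (c : ℕ) < (b : ℕ) + 1)
      = insert b (univ.filter fun c : Fin k => (c : ℕ) < (b : ℕ)) := by
    ext c
    simp only [mem_filter, mem_univ, true_and, mem_insert, Fin.ext_iff]
    omega
  rw [this, Finset.prod_insert (by simp), mul_comm]

lemma qPart_succ (S : Fin k → J → I) (d : J → ℝ) (b : Fin k) (j : J) :
    qPart S d ((b : ℕ) + 1) j = qPart S d b j *
      (colWeight S (b : ℕ) j / colWeight S ((b : ℕ) + 1) j * sPar S d b (S b j)) := by
  unfold qPart
  rw [pPart_succ]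
  have h1 : (0 : ℝ) < colWeight S ((b : ℕ) + 1) j := Nat.cast_pos.2 (colWeight_pos' _ _ _)
  have h2 : (0 : ℝ) < colWeight S (b : ℕ) j := Nat.cast_pos.2 (colWeight_pos' _ _ _)
  field_simp

lemma qPart_congr (S : Fin k → J → I) (d : J → ℝ) (l : ℕ) (j j' : J)
    (h : colEquiv S l j j') : qPart S d l j = qPart S d l j' := by
  unfold qPart pPart
  rw [colWeight_congr h]
  congr 1
  refine Finset.prod_congr rfl fun b hb => ?_
  rw [h b (by simpa using hb)]

lemma key (S : Fin k → J → I) (hF : ∀ b, FloretCondition S b)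
    (hD : ∀ (b : Fin k) j0, dRow S b j0 ∈ Submodule.span ℝ (insert (fun _ => 1) (prefixRows S (b : ℕ))))
    (d : J → ℝ) (hd : ∀ j, 0 < d j) (hd1 : ∑ j, d j = 1) (l : ℕ) (hl : l ≤ k) :
    ∀ v ∈ Submodule.span ℝ (insert (fun _ => (1 : ℝ)) (prefixRows S l)),
      ∑ j, qPart S d l j * v j = ∑ j, d j * v j := by
  induction l with
  | zero =>
    have hne : Nonempty J := by
      by_contra h
      rw [not_nonempty_iff] at h
      simp at hd1
    intro v hv
    have : prefixRows S 0 = ∅ := by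
      ext v; simp [prefixRows]
    rw [this, insert_empty_eq] at hv
    obtain ⟨c, rfl⟩ := Submodule.mem_span_singleton.1 hv
    have hq : ∀ j, qPart S d 0 j = (Fintype.card J : ℝ)⁻¹ := by
      intro j
      simp [qPart, pPart, colWeight, colEquiv]
    simp only [hq, Pi.smul_apply, smul_eq_mul, mul_one]
    rw [← Finset.sum_mul, ← Finset.sum_mul, hd1]
    simp
  | succ l ih =>
    have ih := ih (by omega)
    set b : Fin k := ⟨l, by omega⟩ with hb
    have hbl : l = (b : ℕ) := rfl
    intro v hv
    rw [hbl] at ih hv ⊢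
    clear_value b
    -- class-constant vectors keep their pairing
    have hconst : ∀ v : J → ℝ, (∀ j j', colEquiv S (b : ℕ) j j' → v j = v j') →
        ∑ j, qPart S d ((b : ℕ) + 1) j * v j = ∑ j, qPart S d (b : ℕ) j * v j := by
      intro v hv
      have := avg S b (fun j => qPart S d (b : ℕ) j * v j)
        (fun j j' h => by rw [qPart_congr S d _ j j' h, hv j j' h]) (sPar S d b)
      simp only [sum_sPar (hF b) _ d hd, mul_one] at this
      rw [← this]
      refine Finset.sum_congr rfl fun j _ => ?_
      rw [qPart_succ]; ring
    induction hv using Submodule.span_induction with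
    | zero => simp
    | add x y _ _ hx hy => simp only [Pi.add_apply, mul_add, Finset.sum_add_distrib, hx, hy]
    | smul c x _ hx =>
      simp only [Pi.smul_apply, smul_eq_mul, mul_left_comm _ c, ← Finset.mul_sum, hx]
    | mem v hv =>
      rcases hv with rfl | ⟨c, i, hc, rfl⟩
      · rw [hconst _ (fun _ _ _ => rfl)]
        exact ih _ (Submodule.subset_span (Set.mem_insert _ _))
      · by_cases hcb : (c : ℕ) < b
        · rw [hconst]
          · exact ih _ (Submodule.subset_span (Set.mem_insert_of_mem _ ⟨c, i, hcb, rfl⟩))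
          · intro j j' h
            simp only [rowVec, h c hcb]
        · have : c = b := Fin.ext (by omega)
          subst this
          by_cases hi : ∃ j0, S c j0 = i
          · obtain ⟨j0, rfl⟩ := hi
            have h1 := avg S c (qPart S d (c : ℕ)) (qPart_congr S d _)
              (fun i => if S c j0 = i then sPar S d c i else 0)
            simp only [Finset.sum_ite_eq] at h1
            have h2 := ih _ (hD c j0)
            have h3 : ∑ j, d j * dRow S c j0 j = floretSum S c (S c j0) d := by
              rw [floretSum_eq_dRow (hF c)]
              exact Finset.sum_congr rfl fun j _ => mul_comm _ _
            have h4 : ∑ j, d j * rowVec S c (S c j0) j = rowDot S c (S c j0) d := by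
              simp [rowVec, rowDot]
            rw [h4]
            have h5 : ∑ j, qPart S d ((c : ℕ) + 1) j * rowVec S c (S c j0) j =
                sPar S d c (S c j0) * ∑ j, qPart S d (c : ℕ) j * dRow S c j0 j := by
              rw [Finset.mul_sum]
              trans ∑ j, qPart S d (c : ℕ) j *
                (if S c j0 ∈ stage S c j then sPar S d c (S c j0) else 0)
              · rw [← h1]
                refine Finset.sum_congr rfl fun j _ => ?_
                rw [qPart_succ]
                by_cases hh : S c j = S c j0
                · simp [rowVec, hh]
                · simp [rowVec, hh, Ne.symm hh]
              · refine Finset.sum_congr rfl fun j _ => ?_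
                simp only [mem_stage_iff (hF c)]
                unfold dRow
                split_ifs <;> ring
            rw [h5, h2, h3, sPar, div_mul_cancel₀ _ (floretSum_pos (hF c) j0 d hd).ne']
          · have : ∀ j, rowVec S c i j = 0 := fun j => if_neg fun h => hi ⟨j, h⟩
            simp [this]

lemma comp_mem_span (S : Fin k → J → I) (b : Fin k) (u : I → ℝ) :
    (fun t => u (S b t)) ∈ Submodule.span ℝ (prefixRows S k) := by
  have : (fun t => u (S b t)) = ∑ i ∈ univ.image (S b), u i • rowVec S b i := by
    ext t
    simp [rowVec, Finset.sum_apply]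
  rw [this]
  exact Submodule.sum_mem _ fun i _ =>
    Submodule.smul_mem _ _ (Submodule.subset_span ⟨b, i, b.2, rfl⟩)

lemma isMLE_of {Rows : Set (J → ℝ)} {d p : J → ℝ} (hd : ∀ j, 0 < d j)
    (hp : inModel Rows p) (h : ∀ v ∈ Rows, ∑ j, p j * v j = ∑ j, d j * v j) :
    IsMLE Rows d p := by
  refine ⟨subset_closure hp, ?_⟩
  have hs : ∀ v ∈ Submodule.span ℝ Rows, ∑ j, p j * v j = ∑ j, d j * v j := by
    intro v hv
    induction hv using Submodule.span_induction with
    | zero => simp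
    | add x y _ _ hx hy => simp only [Pi.add_apply, mul_add, Finset.sum_add_distrib, hx, hy]
    | smul c x _ hx =>
      simp only [Pi.smul_apply, smul_eq_mul, mul_left_comm _ c, ← Finset.mul_sum, hx]
    | mem v hv => exact h v hv
  have hcont : Continuous (likelihood d) := by
    unfold likelihood
    refine continuous_finsetProd _ fun j _ => ?_
    exact (Real.continuous_rpow_const (hd j).le).comp (continuous_apply j)
  have hlog : ∀ q : J → ℝ, (∀ j, 0 < q j) →
      likelihood d q = Real.exp (∑ j, d j * Real.log (q j)) := by
    intro q hq
    unfold likelihood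
    rw [Real.exp_sum]
    refine Finset.prod_congr rfl fun j _ => ?_
    rw [Real.rpow_def_of_pos (hq j), mul_comm]
  have hsub : closure {q | inModel Rows q} ⊆ {q | likelihood d q ≤ likelihood d p} := by
    refine closure_minimal ?_ (isClosed_le hcont continuous_const)
    intro q hq
    obtain ⟨hq0, hq1, hq2⟩ := hq
    obtain ⟨hp0, hp1, hp2⟩ := hp
    change likelihood d q ≤ likelihood d p
    rw [hlog q hq0, hlog p hp0, Real.exp_le_exp, ← hs _ hq2, ← hs _ hp2, ← sub_nonpos,
      ← Finset.sum_sub_distrib]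
    calc ∑ j, (p j * Real.log (q j) - p j * Real.log (p j)) ≤ ∑ j, (q j - p j) := by
          refine Finset.sum_le_sum fun j _ => ?_
          have h1 := Real.log_le_sub_one_of_pos (div_pos (hq0 j) (hp0 j))
          rw [Real.log_div (hq0 j).ne' (hp0 j).ne'] at h1
          have h2 := mul_le_mul_of_nonneg_left h1 (hp0 j).le
          have h3 : p j * (q j / p j - 1) = q j - p j := by
            have := (hp0 j).ne'
            field_simp
          linarith
      _ = 0 := by rw [Finset.sum_sub_distrib, hq1, hp1, sub_self]
  exact fun q hq => hsub hq

end helpers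

end PM

open Finset PM in
/-- Proposition 3.19.  Let `A` (encoded by `S`) be a multipartition
matrix with `k` blocks satisfying the GRIP, and let `Ā` (encoded by `Sbar`, with `mbar`
columns) be the matrix obtained from `A` by removing all repeated columns: `r` collapses
each column `j` of `A` onto the column of `Ā` with the same entries (`r` is surjective,
`Sbar b (r j) = S b j`, and `r j = r j'` exactly when columns `j`, `j'` of `A` are
equal).  For normalized positive data `d`, let `d̄_t = Σ_{j : r j = t} d j`.  Then the
MLE of `d̄` in the partition model `M_{Ā}` is `φ_{Ā}(s^1_1(d̄),…,s^k_{n_k}(d̄))`, i.e.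
its `t`-th component is
`∏_{ℓ=1}^k s^ℓ_{S(ℓ,t)}(d̄)` with
`s^ℓ_i(d̄) = (ᾱ^ℓ_i · d̄) / (Σ_{ᾱ^ℓ_{i′} ∈ F^ℓ[i]} ᾱ^ℓ_{i′} · d̄)`. -/
theorem removed_repeats_mle {k m mbar : ℕ} (S : Fin k → Fin m → ℕ) (hgrip : GRIP S)
    (Sbar : Fin k → Fin mbar → ℕ) (r : Fin m → Fin mbar)
    (hr : Function.Surjective r)
    (hcol : ∀ (b : Fin k) (j : Fin m), Sbar b (r j) = S b j)
    (hrinj : ∀ j j' : Fin m, r j = r j' → colEquiv S k j j')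
    (hrrep : ∀ j j' : Fin m, colEquiv S k j j' → r j = r j')
    (d : Fin m → ℝ) (hd : ∀ j, 0 < d j) (hd1 : (∑ j, d j) = 1) :
    IsMLE (prefixRows Sbar k)
      (fun t => ∑ j ∈ univ.filter (fun j => r j = t), d j)
      (fun t => ∏ b : Fin k,
        rowDot Sbar b (Sbar b t) (fun t' => ∑ j ∈ univ.filter (fun j => r j = t'), d j) /
          floretSum Sbar b (Sbar b t)
            (fun t' => ∑ j ∈ univ.filter (fun j => r j = t'), d j)) := by
  set dbar : Fin mbar → ℝ := fun t => ∑ j ∈ univ.filter (fun j => r j = t), d j with hdbar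
  have hF : ∀ b, FloretCondition S b := by
    intro b
    by_cases hb : 0 < (b : ℕ)
    · exact (hgrip b hb).2.1
    · intro j j'
      left
      have : (b : ℕ) = 0 := by omega
      simp [stage, colEquiv, this]
  have hD : ∀ (b : Fin k) j0, dRow S b j0 ∈
      Submodule.span ℝ (insert (fun _ => (1 : ℝ)) (prefixRows S (b : ℕ))) := by
    intro b j0
    by_cases hb : 0 < (b : ℕ)
    · exact Submodule.span_mono (Set.subset_insert _ _) ((hgrip b hb).2.2 j0)
    · have h0 : (b : ℕ) = 0 := by omega
      have : dRow S b j0 = fun _ => (1 : ℝ) := by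
        ext j
        simp [dRow, stage, colEquiv, h0]
      rw [this]
      exact Submodule.subset_span (Set.mem_insert _ _)
  -- summation against `dbar`
  have hsum : ∀ (g : Fin m → ℝ) (v : Fin mbar → ℝ),
      ∑ t, (∑ j ∈ univ.filter (fun j => r j = t), g j) * v t = ∑ j, g j * v (r j) := by
    intro g v
    rw [← Finset.sum_fiberwise univ r]
    refine Finset.sum_congr rfl fun t _ => ?_
    rw [Finset.sum_mul]
    refine Finset.sum_congr rfl fun j hj => ?_
    rw [(Finset.mem_filter.1 hj).2]
  have hdpos : ∀ t, 0 < dbar t := by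
    intro t
    obtain ⟨j, rfl⟩ := hr t
    exact Finset.sum_pos (fun j _ => hd j) ⟨j, by simp⟩
  have hrow : ∀ b i, rowDot Sbar b i dbar = rowDot S b i d := by
    intro b i
    have := hsum d (fun t => if Sbar b t = i then 1 else 0)
    simpa [rowDot, hcol] using this
  have hce : ∀ l j j', colEquiv Sbar l (r j) (r j') ↔ colEquiv S l j j' := by
    intro l j j'
    simp only [colEquiv, hcol]
  have hstage : ∀ b j, stage Sbar b (r j) = stage S b j := by
    intro b j
    ext i
    rw [mem_stage, mem_stage]
    constructor
    · rintro ⟨t, ht, rfl⟩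
      obtain ⟨j', rfl⟩ := hr t
      exact ⟨j', (hce _ _ _).1 ht, (hcol _ _).symm⟩
    · rintro ⟨j', h, rfl⟩
      exact ⟨r j', (hce _ _ _).2 h, hcol _ _⟩
  have hFbar : ∀ b, FloretCondition Sbar b := by
    intro b t t'
    obtain ⟨j, rfl⟩ := hr t
    obtain ⟨j', rfl⟩ := hr t'
    rw [hstage, hstage]
    exact hF b j j'
  have hfs : ∀ b j, floretSum Sbar b (S b j) dbar = floretSum S b (S b j) d := by
    intro b j
    rw [floretSum_eq_sum (hF b), ← hcol b j, floretSum_eq_sum (hFbar b), hstage]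
    simp only [hrow]
  have hp : ∀ j, (∏ b : Fin k, rowDot Sbar b (Sbar b (r j)) dbar /
      floretSum Sbar b (Sbar b (r j)) dbar) = pPart S d k j := by
    intro j
    simp [pPart, sPar, hcol, hrow, hfs]
  have hpq : ∀ t, (∏ b : Fin k, rowDot Sbar b (Sbar b t) dbar /
      floretSum Sbar b (Sbar b t) dbar) =
      ∑ j ∈ univ.filter (fun j => r j = t), qPart S d k j := by
    intro t
    obtain ⟨j, rfl⟩ := hr t
    rw [hp, Finset.sum_congr rfl (g := fun _ => qPart S d k j), Finset.sum_const, nsmul_eq_mul]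
    · have : (univ.filter fun j' => r j' = r j) = univ.filter fun j' => colEquiv S k j j' := by
        ext x
        simp only [mem_filter, mem_univ, true_and]
        exact ⟨fun h => hrinj _ _ h.symm, fun h => (hrrep _ _ h).symm⟩
      rw [this]
      change _ = (colWeight S k j : ℝ) * (_ / _)
      have : (0 : ℝ) < colWeight S k j := Nat.cast_pos.2 (colWeight_pos' _ _ _)
      field_simp
    · intro x hx
      exact qPart_congr S d k x j (hrinj _ _ (by simpa using hx))
  have hkey := key S hF hD d hd hd1 k le_rfl
  have hspos : ∀ b t, 0 < rowDot Sbar b (Sbar b t) dbar / floretSum Sbar b (Sbar b t) dbar :=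
    fun b t => div_pos (rowDot_pos _ _ _ _ hdpos) (floretSum_pos (hFbar b) _ _ hdpos)
  refine isMLE_of hdpos ⟨fun t => Finset.prod_pos fun b _ => hspos b t, ?_, ?_⟩ ?_
  · simp only [hpq]
    have h1 := hsum (qPart S d k) (fun _ => 1)
    have h2 := hkey _ (Submodule.subset_span (Set.mem_insert _ _))
    simp only [mul_one] at h1 h2
    rw [h1, h2, hd1]
  · have : (fun t => Real.log (∏ b : Fin k, rowDot Sbar b (Sbar b t) dbar /
        floretSum Sbar b (Sbar b t) dbar)) =
        ∑ b : Fin k, fun t => Real.log (sPar Sbar dbar b (Sbar b t)) := by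
      ext t
      rw [Real.log_prod (fun b _ => (hspos b t).ne'), Finset.sum_apply]
      rfl
    rw [this]
    exact Submodule.sum_mem _ fun b _ =>
      comp_mem_span Sbar b (fun i => Real.log (sPar Sbar dbar b i))
  · rintro v ⟨b, i, hb, rfl⟩
    simp only [hpq]
    rw [hsum, hdbar, hsum]
    have hv : ∀ j, rowVec Sbar b i (r j) = rowVec S b i j := by
      intro j; simp [rowVec, hcol]
    simp only [hv]
    exact hkey _ (Submodule.subset_span (Set.mem_insert_of_mem _ ⟨b, i, hb, rfl⟩))
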